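/- arXiv:hep-th/9404040 — 6 statements merged into one kernel-verified Lean document; each statement's English description precedes it below -/
import Mathlib

section
/- Let I be an index set and suppose the N×N matrices L_(i) (i ∈ I) over A satisfy, for one fixed N²×N² matrix R over A and all i, j ∈ I, the relation {L_(i) ⊗, L_(j)} = [R, L_(i) ⊗ 1] − [R^π, 1 ⊗ L_(j)]. Then for any two finite words, i.e. any p, q ≥ 1 and any functions w : {1,…,p} → I and v : {1,…,q} → I, one has { Tr(L_(w(1)) L_(w(2)) ⋯ L_(w(p))) , Tr(L_(v(1)) ⋯ L_(v(q))) } = 0 in A. -/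
open Matrix Kronecker

structure PoissonBr (A : Type*) [CommRing A] where
  br : A → A → A
  add_left : ∀ x y z, br (x + y) z = br x z + br y z
  add_right : ∀ x y z, br x (y + z) = br x y + br x z
  antisymm : ∀ x y, br x y = -br y x
  leibniz : ∀ x y z, br x (y * z) = br x y * z + y * br x z

/-- The matrix `{M ⊗, M'}` of pairwise brackets of entries. -/
def matBr {A : Type*} [CommRing A] {N : ℕ} (P : PoissonBr A)
    (M M' : Matrix (Fin N) (Fin N) A) :
    Matrix (Fin N × Fin N) (Fin N × Fin N) A :=
  fun p q => P.br (M p.1 q.1) (M' p.2 q.2)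

/-- `R^π`, the permuted matrix. -/
def piSwap {A : Type*} [CommRing A] {N : ℕ}
    (R : Matrix (Fin N × Fin N) (Fin N × Fin N) A) :
    Matrix (Fin N × Fin N) (Fin N × Fin N) A :=
  fun p q => R (p.2, p.1) (q.2, q.1)

/-- The Casimir matrix `C`, with entries `C_{(i,k),(j,l)} = δ_{il} δ_{kj}`. -/
def casC {A : Type*} [CommRing A] {N : ℕ} :
    Matrix (Fin N × Fin N) (Fin N × Fin N) A :=
  fun p q => if p.1 = q.2 ∧ p.2 = q.1 then 1 else 0

/-- Matrix commutator. -/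
def mComm {A : Type*} [CommRing A] {n : Type*} [Fintype n] (X Y : Matrix n n A) :
    Matrix n n A := X * Y - Y * X

namespace PoissonBr

variable {A : Type*} [CommRing A] (P : PoissonBr A)

/-- The derivation `{x, ·}` as an additive map. -/
def rightHom (x : A) : A →+ A :=
  AddMonoidHom.mk' (P.br x) (P.add_right x)

/-- The derivation `{·, x}` as an additive map. -/
def leftHom (x : A) : A →+ A :=
  AddMonoidHom.mk' (fun y => P.br y x) (fun y z => P.add_left y z x)

lemma br_zero_right (x : A) : P.br x 0 = 0 := map_zero (P.rightHom x)

lemma br_zero_left (x : A) : P.br 0 x = 0 := map_zero (P.leftHom x)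

lemma br_sum_right {ι : Type*} (s : Finset ι) (x : A) (f : ι → A) :
    P.br x (∑ i ∈ s, f i) = ∑ i ∈ s, P.br x (f i) := map_sum (P.rightHom x) f s

lemma br_sum_left {ι : Type*} (s : Finset ι) (x : A) (f : ι → A) :
    P.br (∑ i ∈ s, f i) x = ∑ i ∈ s, P.br (f i) x := map_sum (P.leftHom x) f s

lemma br_one_right (x : A) : P.br x 1 = 0 := by
  simpa using P.leibniz x 1 1

lemma br_one_left (x : A) : P.br 1 x = 0 := by
  rw [P.antisymm, br_one_right, neg_zero]

lemma leibniz_left (x y z : A) : P.br (x * y) z = P.br x z * y + x * P.br y z := by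
  rw [P.antisymm, P.leibniz, P.antisymm z x, P.antisymm z y]
  ring

end PoissonBr

section

variable {A : Type*} [CommRing A] {N : ℕ} (P : PoissonBr A)

lemma matBr_one_left (M : Matrix (Fin N) (Fin N) A) : matBr P 1 M = 0 := by
  ext a b
  by_cases h : a.1 = b.1 <;>
    simp [matBr, Matrix.one_apply, h, P.br_one_left, P.br_zero_left]

lemma matBr_mul_left (X Y M : Matrix (Fin N) (Fin N) A) :
    matBr P (X * Y) M = matBr P X M * (Y ⊗ₖ (1 : Matrix (Fin N) (Fin N) A)) +
      (X ⊗ₖ (1 : Matrix (Fin N) (Fin N) A)) * matBr P Y M := by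
  ext a b
  simp [matBr, Matrix.mul_apply, Fintype.sum_prod_type, P.br_sum_left, P.leibniz_left,
    Finset.sum_add_distrib, Matrix.one_apply]

lemma map_br_mul (x : A) (X Y : Matrix (Fin N) (Fin N) A) :
    (X * Y).map (P.br x) = X.map (P.br x) * Y + X * Y.map (P.br x) := by
  ext a b
  simp [Matrix.mul_apply, P.br_sum_right, P.leibniz, Finset.sum_add_distrib]

lemma map_br_one (x : A) : (1 : Matrix (Fin N) (Fin N) A).map (P.br x) = 0 := by
  ext a b
  by_cases h : a = b <;> simp [h, P.br_one_right, P.br_zero_right]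

/-- The partial trace over the first tensor factor. -/
def partialTrace (X : Matrix (Fin N × Fin N) (Fin N × Fin N) A) :
    Matrix (Fin N) (Fin N) A :=
  fun k l => ∑ i, X (i, k) (i, l)

lemma partialTrace_sub (X Y : Matrix (Fin N × Fin N) (Fin N × Fin N) A) :
    partialTrace (X - Y) = partialTrace X - partialTrace Y := by
  ext k l
  simp [partialTrace]

lemma partialTrace_matBr (X M : Matrix (Fin N) (Fin N) A) :
    partialTrace (matBr P X M) = M.map (P.br X.trace) := by
  ext k l
  simp [partialTrace, matBr, Matrix.trace, P.br_sum_left]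

lemma partialTrace_mComm_kronecker_one (X : Matrix (Fin N × Fin N) (Fin N × Fin N) A)
    (M : Matrix (Fin N) (Fin N) A) :
    partialTrace (mComm X (M ⊗ₖ (1 : Matrix (Fin N) (Fin N) A))) = 0 := by
  ext k l
  simp only [partialTrace, mComm, Matrix.sub_apply, Matrix.mul_apply, Fintype.sum_prod_type,
    kroneckerMap_apply, Matrix.one_apply, mul_ite, ite_mul, mul_one, mul_zero, zero_mul,
    Finset.sum_ite_eq, Finset.sum_ite_eq', Finset.mem_univ, if_true, Finset.sum_sub_distrib,
    Matrix.zero_apply]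
  rw [sub_eq_zero, Finset.sum_comm]
  simp only [mul_comm]

lemma partialTrace_mComm_one_kronecker (X : Matrix (Fin N × Fin N) (Fin N × Fin N) A)
    (M : Matrix (Fin N) (Fin N) A) :
    partialTrace (mComm X ((1 : Matrix (Fin N) (Fin N) A) ⊗ₖ M)) =
      mComm (partialTrace X) M := by
  ext k l
  simp only [partialTrace, mComm, Matrix.sub_apply, Matrix.mul_apply, Fintype.sum_prod_type_right,
    kroneckerMap_apply, Matrix.one_apply, mul_ite, ite_mul, one_mul, mul_zero, zero_mul,
    Finset.sum_ite_eq, Finset.sum_ite_eq', Finset.mem_univ, if_true, Finset.sum_sub_distrib,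
    Finset.sum_mul, Finset.mul_sum]
  congr 1 <;> exact Finset.sum_comm

variable {I : Type*} {L : I → Matrix (Fin N) (Fin N) A}
  {R : Matrix (Fin N × Fin N) (Fin N × Fin N) A}

lemma exists_matBr_prod_eq
    (hL : ∀ i j, matBr P (L i) (L j) =
      mComm R ((L i) ⊗ₖ (1 : Matrix (Fin N) (Fin N) A)) -
        mComm (piSwap R) ((1 : Matrix (Fin N) (Fin N) A) ⊗ₖ (L j))) (w : List I) :
    ∃ T : Matrix (Fin N × Fin N) (Fin N × Fin N) A, ∀ j,
      matBr P (w.map L).prod (L j) =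
        mComm R ((w.map L).prod ⊗ₖ (1 : Matrix (Fin N) (Fin N) A)) -
          mComm T ((1 : Matrix (Fin N) (Fin N) A) ⊗ₖ (L j)) := by
  induction w with
  | nil => exact ⟨0, fun j => by simp [matBr_one_left, mComm]⟩
  | cons i w ih =>
    obtain ⟨T, hT⟩ := ih
    simp only [List.map_cons, List.prod_cons]
    generalize (w.map L).prod = W at hT ⊢
    refine ⟨piSwap R * (W ⊗ₖ (1 : Matrix (Fin N) (Fin N) A)) +
      (L i ⊗ₖ (1 : Matrix (Fin N) (Fin N) A)) * T, fun j => ?_⟩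
    have hmul : (L i * W) ⊗ₖ (1 : Matrix (Fin N) (Fin N) A) =
        (L i ⊗ₖ (1 : Matrix (Fin N) (Fin N) A)) * (W ⊗ₖ (1 : Matrix (Fin N) (Fin N) A)) := by
      rw [← Matrix.mul_kronecker_mul, one_mul]
    have hcomm (X : Matrix (Fin N) (Fin N) A) :
        (X ⊗ₖ (1 : Matrix (Fin N) (Fin N) A)) * ((1 : Matrix (Fin N) (Fin N) A) ⊗ₖ L j) =
          ((1 : Matrix (Fin N) (Fin N) A) ⊗ₖ L j) * (X ⊗ₖ (1 : Matrix (Fin N) (Fin N) A)) := by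
      simp only [← Matrix.mul_kronecker_mul, one_mul, mul_one]
    have hW := hcomm W
    have hLi := hcomm (L i)
    rw [matBr_mul_left, hL, hT, hmul]
    simp only [mComm]
    generalize W ⊗ₖ (1 : Matrix (Fin N) (Fin N) A) = w₁ at *
    generalize L i ⊗ₖ (1 : Matrix (Fin N) (Fin N) A) = l₁ at *
    generalize (1 : Matrix (Fin N) (Fin N) A) ⊗ₖ L j = l₂ at *
    have h₁ : piSwap R * w₁ * l₂ = piSwap R * l₂ * w₁ := by
      rw [mul_assoc, hW, mul_assoc]
    have h₂ : l₂ * (l₁ * T) = l₁ * (l₂ * T) := by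
      rw [← mul_assoc, ← hLi, mul_assoc]
    rw [add_mul, mul_add, h₁, h₂]
    noncomm_ring

/-- Each trace of a word generates a Lax flow on all the matrices `L j`. -/
lemma exists_map_br_trace_eq_mComm
    (hL : ∀ i j, matBr P (L i) (L j) =
      mComm R ((L i) ⊗ₖ (1 : Matrix (Fin N) (Fin N) A)) -
        mComm (piSwap R) ((1 : Matrix (Fin N) (Fin N) A) ⊗ₖ (L j))) (w : List I) :
    ∃ B : Matrix (Fin N) (Fin N) A, ∀ j,
      (L j).map (P.br (w.map L).prod.trace) = mComm B (L j) := by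
  obtain ⟨T, hT⟩ := exists_matBr_prod_eq P hL w
  refine ⟨-partialTrace T, fun j => ?_⟩
  rw [← partialTrace_matBr, hT, partialTrace_sub, partialTrace_mComm_kronecker_one,
    partialTrace_mComm_one_kronecker]
  simp only [mComm]
  noncomm_ring

lemma map_br_prod_eq_mComm {x : A} {B : Matrix (Fin N) (Fin N) A}
    (hB : ∀ j, (L j).map (P.br x) = mComm B (L j)) (v : List I) :
    (v.map L).prod.map (P.br x) = mComm B (v.map L).prod := by
  induction v with
  | nil => simp [map_br_one, mComm]
  | cons j v ih =>
    rw [List.map_cons, List.prod_cons, map_br_mul, hB, ih]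
    simp only [mComm]
    noncomm_ring

lemma br_trace_prod_trace_prod
    (hL : ∀ i j, matBr P (L i) (L j) =
      mComm R ((L i) ⊗ₖ (1 : Matrix (Fin N) (Fin N) A)) -
        mComm (piSwap R) ((1 : Matrix (Fin N) (Fin N) A) ⊗ₖ (L j))) (w v : List I) :
    P.br (w.map L).prod.trace (v.map L).prod.trace = 0 := by
  obtain ⟨B, hB⟩ := exists_map_br_trace_eq_mComm P hL w
  have h := congrArg Matrix.trace (map_br_prod_eq_mComm P hB v)
  rw [mComm, Matrix.trace_sub, Matrix.trace_mul_comm, sub_self] at h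
  rw [← h]
  exact P.br_sum_right _ _ _

end

theorem statement0 {A : Type*} [CommRing A] {N : ℕ} (P : PoissonBr A)
    {I : Type*} (L : I → Matrix (Fin N) (Fin N) A)
    (R : Matrix (Fin N × Fin N) (Fin N × Fin N) A)
    (hL : ∀ i j, matBr P (L i) (L j) =
      mComm R ((L i) ⊗ₖ (1 : Matrix (Fin N) (Fin N) A)) -
        mComm (piSwap R) ((1 : Matrix (Fin N) (Fin N) A) ⊗ₖ (L j))) :
    ∀ (p q : ℕ), 1 ≤ p → 1 ≤ q → ∀ (w : Fin p → I) (v : Fin q → I),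
      P.br ((List.ofFn fun k => L (w k)).prod).trace
        ((List.ofFn fun k => L (v k)).prod).trace = 0 := by
  intro p q _ _ w v
  have h := br_trace_prod_trace_prod P hL (List.ofFn w) (List.ofFn v)
  rwa [List.map_ofFn, List.map_ofFn] at h
end

section
/- For every l ≥ 0, every word (B_1, …, B_l) with each B_k ∈ {L, Q}, and every choice of N, r ≥ 1 and 1 ≤ a, b ≤ r, there exist polynomials P and P^{ab} with integer coefficients in the variables X_α, X_{p,q} (p, q ≥ 0, p + q ≤ l) and Y^{cd}_{p,q} (1 ≤ c, d ≤ r, p + q ≤ l), such that: for every commutative ring A, every α ∈ A, all ξ_i^a, η_i^a ∈ A, and all N×N matrices L, Q over A satisfying [L, Q] = F − α·1, one has Tr(B_1 ⋯ B_l) = P and Tr(B_1 ⋯ B_l F^{ab}) = P^{ab}, where in P and P^{ab} the variable X_α is evaluated at α, X_{p,q} at the normal-ordered generator Tr(L^p Q^q), and Y^{cd}_{p,q} at Tr(L^p Q^q F^{cd}). -/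
open Matrix

/-- The rank-one matrices `F^{ab}` with entries `(F^{ab})_{ij} = ξ_i^b η_j^a`. -/
def Fab {A : Type*} [CommRing A] {N r : ℕ} (ξ η : Fin N → Fin r → A)
    (a b : Fin r) : Matrix (Fin N) (Fin N) A :=
  Matrix.of fun i j => ξ i b * η j a

/-- `F = Σ_a F^{aa}`. -/
def Fmat {A : Type*} [CommRing A] {N r : ℕ} (ξ η : Fin N → Fin r → A) :
    Matrix (Fin N) (Fin N) A :=
  ∑ a, Fab ξ η a a

/-- Variables for the normal-ordering polynomials: `X_α`, `X_{p,q}` (`p+q ≤ l`),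
and `Y^{cd}_{p,q}` (`p+q ≤ l`). -/
def RatVars (r l : ℕ) : Type :=
  Unit ⊕ {pq : ℕ × ℕ // pq.1 + pq.2 ≤ l} ⊕
    ((Fin r × Fin r) × {pq : ℕ × ℕ // pq.1 + pq.2 ≤ l})

/-- Evaluation of the normal-ordering variables at `α`, `Tr (L ^ p * Q ^ q)` and
`Tr (L ^ p * Q ^ q * F^{cd})`. -/
def ratVarsEval {A : Type*} [CommRing A] {N r : ℕ} (l : ℕ) (α : A) (ξ η : Fin N → Fin r → A)
    (L Q : Matrix (Fin N) (Fin N) A) (v : RatVars r l) : A :=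
  match v with
  | Sum.inl _ => α
  | Sum.inr (Sum.inl pq) => (L ^ pq.1.1 * Q ^ pq.1.2).trace
  | Sum.inr (Sum.inr cdpq) =>
      (L ^ cdpq.2.1.1 * Q ^ cdpq.2.1.2 * Fab ξ η cdpq.1.1 cdpq.1.2).trace

/-- The product of a word in two letters, `true` standing for `L` and `false` for `Q`. -/
def wordProd {M : Type*} [Monoid M] (L Q : M) (w : List Bool) : M :=
  (w.map fun b => if b then L else Q).prod

section Word

variable {M : Type*} [Monoid M] (L Q : M)

@[simp]
lemma wordProd_nil : wordProd L Q [] = 1 := rfl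

@[simp]
lemma wordProd_cons (b : Bool) (w : List Bool) :
    wordProd L Q (b :: w) = (if b then L else Q) * wordProd L Q w := by
  simp [wordProd]

@[simp]
lemma wordProd_append (u v : List Bool) :
    wordProd L Q (u ++ v) = wordProd L Q u * wordProd L Q v := by
  simp [wordProd]

lemma wordProd_replicate_append_replicate (p q : ℕ) :
    wordProd L Q (List.replicate p true ++ List.replicate q false) = L ^ p * Q ^ q := by
  simp [wordProd]

lemma map_wordProd {M' F : Type*} [Monoid M'] [FunLike F M M'] [MonoidHomClass F M M'] (f : F)
    (w : List Bool) :
    f (wordProd L Q w) = wordProd (f L) (f Q) w := by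
  induction w with
  | nil => simp
  | cons b w ih => cases b <;> simp [ih]

end Word

section RankOne

variable {A : Type*} [CommRing A] {N r : ℕ} (ξ η : Fin N → Fin r → A)

lemma Fab_eq_vecMulVec (a b : Fin r) :
    Fab ξ η a b = vecMulVec (fun i => ξ i b) (fun j => η j a) := rfl

lemma trace_mul_Fab (X : Matrix (Fin N) (Fin N) A) (a b : Fin r) :
    (X * Fab ξ η a b).trace = (X *ᵥ fun i => ξ i b) ⬝ᵥ fun j => η j a := by
  rw [Fab_eq_vecMulVec, mul_vecMulVec, trace_vecMulVec]

lemma trace_mul_Fab_mul_mul_Fab (U V : Matrix (Fin N) (Fin N) A) (a b c d : Fin r) :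
    (U * Fab ξ η c d * V * Fab ξ η a b).trace =
      (U * Fab ξ η a d).trace * (V * Fab ξ η c b).trace := by
  simp only [Fab_eq_vecMulVec, mul_vecMulVec, ← mulVec_mulVec, vecMulVec_mulVec]
  simp [dotProduct_comm, mul_comm]

/-- The matrices whose trace, and whose traces against all the `F^{ab}`, lie in `S`. -/
def traceSubgroup (S : Subalgebra ℤ A) : AddSubgroup (Matrix (Fin N) (Fin N) A) where
  carrier := {X | X.trace ∈ S ∧ ∀ a b, (X * Fab ξ η a b).trace ∈ S}
  zero_mem' := by simp
  add_mem' hX hY := by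
    refine ⟨?_, fun a b => ?_⟩
    · rw [trace_add]; exact add_mem hX.1 hY.1
    · rw [add_mul, trace_add]; exact add_mem (hX.2 a b) (hY.2 a b)
  neg_mem' hX := by
    refine ⟨?_, fun a b => ?_⟩
    · rw [trace_neg]; exact neg_mem hX.1
    · rw [neg_mul, trace_neg]; exact neg_mem (hX.2 a b)

variable {ξ η} {S : Subalgebra ℤ A}

lemma mul_Fab_mul_mem_traceSubgroup {U V : Matrix (Fin N) (Fin N) A}
    (hU : U ∈ traceSubgroup ξ η S) (hV : V ∈ traceSubgroup ξ η S)
    (hVU : V * U ∈ traceSubgroup ξ η S) (c d : Fin r) :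
    U * Fab ξ η c d * V ∈ traceSubgroup ξ η S := by
  refine ⟨?_, fun a b => ?_⟩
  · rw [trace_mul_comm, ← mul_assoc]
    exact hVU.2 c d
  · rw [trace_mul_Fab_mul_mul_Fab]
    exact mul_mem (hU.2 a d) (hV.2 c b)

lemma smul_mem_traceSubgroup {α : A} (hα : α ∈ S) {X : Matrix (Fin N) (Fin N) A}
    (hX : X ∈ traceSubgroup ξ η S) : α • X ∈ traceSubgroup ξ η S := by
  refine ⟨?_, fun a b => ?_⟩
  · rw [trace_smul]; exact mul_mem hα hX.1
  · rw [smul_mul_assoc, trace_smul]; exact mul_mem hα (hX.2 a b)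

variable {α : A} {L Q : Matrix (Fin N) (Fin N) A}

lemma mul_commutator_mul_mem_traceSubgroup
    (h : L * Q - Q * L = Fmat ξ η - α • (1 : Matrix (Fin N) (Fin N) A)) (hα : α ∈ S)
    {U V : Matrix (Fin N) (Fin N) A} (hU : U ∈ traceSubgroup ξ η S)
    (hV : V ∈ traceSubgroup ξ η S) (hUV : U * V ∈ traceSubgroup ξ η S)
    (hVU : V * U ∈ traceSubgroup ξ η S) :
    U * (L * Q - Q * L) * V ∈ traceSubgroup ξ η S := by
  have key : U * (L * Q - Q * L) * V = ∑ c, U * Fab ξ η c c * V - α • (U * V) := by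
    rw [h, Fmat, mul_sub, sub_mul, Finset.mul_sum, Finset.sum_mul]
    simp
  rw [key]
  exact sub_mem (sum_mem fun c _ => mul_Fab_mul_mem_traceSubgroup hU hV hVU c c)
    (smul_mem_traceSubgroup hα hUV)

lemma wordProd_sub_wordProd_mem_of_perm
    (h : L * Q - Q * L = Fmat ξ η - α • (1 : Matrix (Fin N) (Fin N) A)) (hα : α ∈ S) {n : ℕ}
    (ih : ∀ w : List Bool, w.length < n → wordProd L Q w ∈ traceSubgroup ξ η S)
    {w w' : List Bool} (hw : w.Perm w') (u : List Bool) (hn : (u ++ w).length ≤ n) :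
    wordProd L Q (u ++ w) - wordProd L Q (u ++ w') ∈ traceSubgroup ξ η S := by
  induction hw generalizing u with
  | nil => simp
  | cons x _ hperm => simpa using hperm (u ++ [x]) (by simpa using hn)
  | trans h₁ _ ih₁ ih₂ =>
    have hn' := hn
    rw [List.length_append, h₁.length_eq, ← List.length_append] at hn'
    simpa using add_mem (ih₁ u hn) (ih₂ u hn')
  | swap x y v =>
    simp only [List.length_append, List.length_cons] at hn
    have hmem : wordProd L Q u * (L * Q - Q * L) * wordProd L Q v ∈ traceSubgroup ξ η S := by
      refine mul_commutator_mul_mem_traceSubgroup h hα (ih u (by lia)) (ih v (by lia)) ?_ ?_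
      · rw [← wordProd_append]
        exact ih _ (by simp only [List.length_append]; lia)
      · rw [← wordProd_append]
        exact ih _ (by simp only [List.length_append]; lia)
    cases x <;> cases y
    · simp
    · convert hmem using 1
      simp [mul_sub, sub_mul, mul_assoc]
    · convert neg_mem hmem using 1
      simp [mul_sub, sub_mul, mul_assoc]
    · simp

theorem wordProd_mem_traceSubgroup
    (h : L * Q - Q * L = Fmat ξ η - α • (1 : Matrix (Fin N) (Fin N) A)) (hα : α ∈ S) {l : ℕ}
    (hS : ∀ p q, p + q ≤ l → L ^ p * Q ^ q ∈ traceSubgroup ξ η S) (w : List Bool)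
    (hw : w.length ≤ l) : wordProd L Q w ∈ traceSubgroup ξ η S := by
  induction hn : w.length using Nat.strong_induction_on generalizing w with
  | _ n ih =>
    have hperm : w.Perm
        (List.replicate (w.count true) true ++ List.replicate (w.count false) false) :=
      (List.perm_replicate_append_replicate (by simp)).2
        ⟨rfl, rfl, fun b _ => by cases b <;> simp⟩
    have hsub := wordProd_sub_wordProd_mem_of_perm h hα
      (fun v hv => ih v.length hv v (by lia) rfl) hperm [] (by simp [hn])
    rw [List.nil_append, List.nil_append, wordProd_replicate_append_replicate] at hsub
    have hlen := hperm.length_eq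
    simp only [List.length_append, List.length_replicate] at hlen
    simpa using add_mem hsub (hS (w.count true) (w.count false) (by lia))

theorem wordProd_mem_traceSubgroup_range
    (h : L * Q - Q * L = Fmat ξ η - α • (1 : Matrix (Fin N) (Fin N) A)) {l : ℕ} (w : List Bool)
    (hw : w.length ≤ l) :
    wordProd L Q w ∈
      traceSubgroup ξ η (MvPolynomial.aeval (R := ℤ) (ratVarsEval l α ξ η L Q)).range := by
  refine wordProd_mem_traceSubgroup h ((AlgHom.mem_range _).2 ⟨.X (Sum.inl ()), MvPolynomial.aeval_X _ _⟩)
    (l := l)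
    (fun p q hpq => ⟨?_, fun a b => ?_⟩) w hw
  · exact ⟨.X (Sum.inr (Sum.inl ⟨(p, q), hpq⟩)), MvPolynomial.aeval_X _ _⟩
  · exact ⟨.X (Sum.inr (Sum.inr ((a, b), ⟨(p, q), hpq⟩))), MvPolynomial.aeval_X _ _⟩

end RankOne

section BaseChange

variable {A B : Type*} [CommRing A] [CommRing B] (f : A →+* B) {N r : ℕ}
  (ξ η : Fin N → Fin r → A)

lemma mapMatrix_Fab (a b : Fin r) :
    f.mapMatrix (Fab ξ η a b) = Fab (fun i c => f (ξ i c)) (fun i c => f (η i c)) a b := by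
  ext i j
  simp [Fab]

lemma map_trace_eq (X : Matrix (Fin N) (Fin N) A) : f X.trace = (f.mapMatrix X).trace := by
  simp [Matrix.trace]

lemma map_ratVarsEval (l : ℕ) (α : A) (L Q : Matrix (Fin N) (Fin N) A) (v : RatVars r l) :
    f (ratVarsEval l α ξ η L Q v) = ratVarsEval l (f α) (fun i c => f (ξ i c))
      (fun i c => f (η i c)) (f.mapMatrix L) (f.mapMatrix Q) v := by
  rcases v with _ | _ | _
  · rfl
  · simp only [ratVarsEval, map_trace_eq, map_mul, map_pow]
  · simp only [ratVarsEval, map_trace_eq, map_mul, map_pow, mapMatrix_Fab]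

lemma map_aeval_ratVarsEval (l : ℕ) (α : A) (L Q : Matrix (Fin N) (Fin N) A)
    (P : MvPolynomial (RatVars r l) ℤ) :
    f (MvPolynomial.aeval (ratVarsEval l α ξ η L Q) P) =
      MvPolynomial.aeval (ratVarsEval l (f α) (fun i c => f (ξ i c)) (fun i c => f (η i c))
        (f.mapMatrix L) (f.mapMatrix Q)) P := by
  have := MvPolynomial.comp_aeval_apply (ratVarsEval l α ξ η L Q) f.toIntAlgHom P
  simpa [map_ratVarsEval] using this

end BaseChange

/-- A solution of `[L, Q] = F - α • 1` over some commutative ring. -/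
structure CommutatorSolution (N r : ℕ) where
  A : Type
  [commRing : CommRing A]
  α : A
  ξ : Fin N → Fin r → A
  η : Fin N → Fin r → A
  L : Matrix (Fin N) (Fin N) A
  Q : Matrix (Fin N) (Fin N) A
  commutator_eq : L * Q - Q * L = Fmat ξ η - α • (1 : Matrix (Fin N) (Fin N) A)

attribute [instance] CommutatorSolution.commRing

/-- Polynomial expressions that do not depend on the solution exist because the product of all
solutions is again a solution. -/
theorem exists_polynomial_trace_wordProd (N r l : ℕ) (w : List Bool) (hw : w.length ≤ l)
    (a b : Fin r) :
    ∃ P Pab : MvPolynomial (RatVars r l) ℤ, ∀ D : CommutatorSolution N r,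
      (wordProd D.L D.Q w).trace =
          MvPolynomial.aeval (ratVarsEval l D.α D.ξ D.η D.L D.Q) P ∧
        (wordProd D.L D.Q w * Fab D.ξ D.η a b).trace =
          MvPolynomial.aeval (ratVarsEval l D.α D.ξ D.η D.L D.Q) Pab := by
  let α : ∀ D : CommutatorSolution N r, D.A := fun D => D.α
  let ξ : Fin N → Fin r → ∀ D : CommutatorSolution N r, D.A := fun i c D => D.ξ i c
  let η : Fin N → Fin r → ∀ D : CommutatorSolution N r, D.A := fun i c D => D.η i c
  let L : Matrix (Fin N) (Fin N) (∀ D : CommutatorSolution N r, D.A) :=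
    of fun i j D => D.L i j
  let Q : Matrix (Fin N) (Fin N) (∀ D : CommutatorSolution N r, D.A) :=
    of fun i j D => D.Q i j
  have h : L * Q - Q * L = Fmat ξ η - α • (1 : Matrix (Fin N) (Fin N) _) := by
    ext i j D
    have hD := congrFun (congrFun D.commutator_eq i) j
    by_cases hij : i = j <;>
      simpa [Matrix.mul_apply, Fmat, Fab, Matrix.sum_apply, Matrix.one_apply, hij,
        α, ξ, η, L, Q] using hD
  obtain ⟨⟨P, hP⟩, hab⟩ := wordProd_mem_traceSubgroup_range h w hw
  obtain ⟨Pab, hPab⟩ := hab a b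
  refine ⟨P, Pab, fun D => ?_⟩
  let f := Pi.evalRingHom (fun D : CommutatorSolution N r => D.A) D
  have hword : f.mapMatrix (wordProd L Q w) = wordProd D.L D.Q w :=
    map_wordProd L Q f.mapMatrix w
  constructor
  · have := congrArg f hP
    rw [AlgHom.toRingHom_eq_coe, RingHom.coe_coe, map_aeval_ratVarsEval, map_trace_eq, hword]
      at this
    exact this.symm
  · have := congrArg f hPab
    rw [AlgHom.toRingHom_eq_coe, RingHom.coe_coe, map_aeval_ratVarsEval, map_trace_eq, map_mul,
      hword, mapMatrix_Fab] at this
    exact this.symm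

theorem statement4 (l : ℕ) (w : Fin l → Bool) (N r : ℕ) (hN : 1 ≤ N) (hr : 1 ≤ r)
    (a b : Fin r) :
    ∃ P Pab : MvPolynomial (RatVars r l) ℤ,
      ∀ (A : Type) (_ : CommRing A) (α : A) (ξ η : Fin N → Fin r → A)
        (L Q : Matrix (Fin N) (Fin N) A),
        L * Q - Q * L = Fmat ξ η - α • (1 : Matrix (Fin N) (Fin N) A) →
        ((List.ofFn fun k => if w k then L else Q).prod).trace =
            MvPolynomial.aeval
              (fun v : RatVars r l =>
                match v with
                | Sum.inl _ => α
                | Sum.inr (Sum.inl pq) => (L ^ pq.1.1 * Q ^ pq.1.2).trace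
                | Sum.inr (Sum.inr cdpq) =>
                    (L ^ cdpq.2.1.1 * Q ^ cdpq.2.1.2 *
                      Fab ξ η cdpq.1.1 cdpq.1.2).trace) P ∧
          ((List.ofFn fun k => if w k then L else Q).prod * Fab ξ η a b).trace =
            MvPolynomial.aeval
              (fun v : RatVars r l =>
                match v with
                | Sum.inl _ => α
                | Sum.inr (Sum.inl pq) => (L ^ pq.1.1 * Q ^ pq.1.2).trace
                | Sum.inr (Sum.inr cdpq) =>
                    (L ^ cdpq.2.1.1 * Q ^ cdpq.2.1.2 *
                      Fab ξ η cdpq.1.1 cdpq.1.2).trace) Pab := by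
  obtain ⟨P, Pab, h⟩ := exists_polynomial_trace_wordProd N r l (List.ofFn w) (by simp) a b
  refine ⟨P, Pab, fun A _ α ξ η L Q hLQ => ?_⟩
  have hw : (List.ofFn fun k => if w k then L else Q).prod = wordProd L Q (List.ofFn w) := by
    rw [wordProd, List.map_ofFn]
    rfl
  have hv : (fun v : RatVars r l =>
      match v with
      | Sum.inl _ => α
      | Sum.inr (Sum.inl pq) => (L ^ pq.1.1 * Q ^ pq.1.2).trace
      | Sum.inr (Sum.inr cdpq) =>
          (L ^ cdpq.2.1.1 * Q ^ cdpq.2.1.2 * Fab ξ η cdpq.1.1 cdpq.1.2).trace) =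
      ratVarsEval l α ξ η L Q := by
    funext v
    rcases v with _ | _ | _ <;> rfl
  rw [hw, hv]
  exact h ⟨A, α, ξ, η, L, Q, hLQ⟩
end

section
/- Suppose the N×N matrices F^{ab} (1 ≤ a,b ≤ r) over A satisfy {F^{ab} ⊗, F^{cd}} = (δ_{ad} F^{cb} ⊗ 1 − δ_{cb} 1 ⊗ F^{ad})·C for all a, b, c, d. Define F = Σ_{a=1}^r F^{aa} and F̃^{ab} = F^{ab} − (δ_{ab}/r) F. Then for all a, b, c, d: {F̃^{ab} ⊗, F̃^{cd}} = (δ_{ad} F̃^{cb} ⊗ 1 − δ_{cb} 1 ⊗ F̃^{ad})·C − (δ_{ab}/r)(F̃^{cd} ⊗ 1 − 1 ⊗ F̃^{cd})·C − (δ_{cd}/r)(F̃^{ab} ⊗ 1 − 1 ⊗ F̃^{ab})·C + (1/r)(δ_{ad}δ_{cb} − (1/r)δ_{ab}δ_{cd})(F ⊗ 1 − 1 ⊗ F)·C. -/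
open Matrix Kronecker

/-- The bracket matrix `matBr` as a biadditive map. -/
def matBrHom {A : Type*} [CommRing A] {N : ℕ} (P : PoissonBr A) :
    Matrix (Fin N) (Fin N) A →+ Matrix (Fin N) (Fin N) A →+
      Matrix (Fin N × Fin N) (Fin N × Fin N) A :=
  AddMonoidHom.mk'
    (fun M => AddMonoidHom.mk' (matBr P M) fun _ _ => by ext; exact P.add_right _ _ _)
    fun _ _ => by ext; exact P.add_left _ _ _

theorem matBrHom_apply {A : Type*} [CommRing A] {N : ℕ} (P : PoissonBr A)
    (M L : Matrix (Fin N) (Fin N) A) : matBrHom P M L = matBr P M L := rfl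

theorem matBrHom_smul_left {A : Type*} [CommRing A] [Algebra ℚ A] {N : ℕ} (P : PoissonBr A)
    (t : ℚ) (M L : Matrix (Fin N) (Fin N) A) :
    matBrHom P (t • M) L = t • matBrHom P M L :=
  map_rat_smul ((matBrHom P).flip L) t M

theorem matBrHom_smul_right {A : Type*} [CommRing A] [Algebra ℚ A] {N : ℕ} (P : PoissonBr A)
    (t : ℚ) (M L : Matrix (Fin N) (Fin N) A) :
    matBrHom P M (t • L) = t • matBrHom P M L :=
  map_rat_smul (matBrHom P M) t L

/-- The map `X ↦ (X ⊗ 1) C`. -/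
def kronOneMulC {A : Type*} [CommRing A] [Algebra ℚ A] {N : ℕ} :
    Matrix (Fin N) (Fin N) A →ₗ[ℚ] Matrix (Fin N × Fin N) (Fin N × Fin N) A where
  toFun X := (X ⊗ₖ (1 : Matrix (Fin N) (Fin N) A)) * casC
  map_add' X Y := by rw [add_kronecker, add_mul]
  map_smul' t X := by rw [smul_kronecker, smul_mul_assoc, RingHom.id_apply]

/-- The map `X ↦ (1 ⊗ X) C`. -/
def oneKronMulC {A : Type*} [CommRing A] [Algebra ℚ A] {N : ℕ} :
    Matrix (Fin N) (Fin N) A →ₗ[ℚ] Matrix (Fin N × Fin N) (Fin N × Fin N) A where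
  toFun X := ((1 : Matrix (Fin N) (Fin N) A) ⊗ₖ X) * casC
  map_add' X Y := by rw [kronecker_add, add_mul]
  map_smul' t X := by rw [kronecker_smul, smul_mul_assoc, RingHom.id_apply]

theorem statement6 {A : Type*} [CommRing A] [Algebra ℚ A] {N : ℕ} (P : PoissonBr A)
    {r : ℕ} (hr : 1 ≤ r) (F : Fin r → Fin r → Matrix (Fin N) (Fin N) A)
    (hFF : ∀ a b c d, matBr P (F a b) (F c d) =
      ((if a = d then (1 : A) else 0) • ((F c b) ⊗ₖ (1 : Matrix (Fin N) (Fin N) A)) -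
        (if c = b then (1 : A) else 0) • ((1 : Matrix (Fin N) (Fin N) A) ⊗ₖ F a d)) * casC) :
    ∀ a b c d,
      matBr P (F a b - (if a = b then ((r : ℚ)⁻¹) else 0) • ∑ e, F e e)
        (F c d - (if c = d then ((r : ℚ)⁻¹) else 0) • ∑ e, F e e) =
      ((if a = d then (1 : A) else 0) •
          ((F c b - (if c = b then ((r : ℚ)⁻¹) else 0) • ∑ e, F e e) ⊗ₖ
            (1 : Matrix (Fin N) (Fin N) A)) -
        (if c = b then (1 : A) else 0) •
          ((1 : Matrix (Fin N) (Fin N) A) ⊗ₖ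
            (F a d - (if a = d then ((r : ℚ)⁻¹) else 0) • ∑ e, F e e))) * casC -
      (if a = b then ((r : ℚ)⁻¹) else 0) •
        (((F c d - (if c = d then ((r : ℚ)⁻¹) else 0) • ∑ e, F e e) ⊗ₖ
            (1 : Matrix (Fin N) (Fin N) A) -
          (1 : Matrix (Fin N) (Fin N) A) ⊗ₖ
            (F c d - (if c = d then ((r : ℚ)⁻¹) else 0) • ∑ e, F e e)) * casC) -
      (if c = d then ((r : ℚ)⁻¹) else 0) •
        (((F a b - (if a = b then ((r : ℚ)⁻¹) else 0) • ∑ e, F e e) ⊗ₖ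
            (1 : Matrix (Fin N) (Fin N) A) -
          (1 : Matrix (Fin N) (Fin N) A) ⊗ₖ
            (F a b - (if a = b then ((r : ℚ)⁻¹) else 0) • ∑ e, F e e)) * casC) +
      ((r : ℚ)⁻¹ * ((if a = d then 1 else 0) * (if c = b then 1 else 0) -
          (r : ℚ)⁻¹ * ((if a = b then 1 else 0) * (if c = d then 1 else 0)))) •
        (((∑ e, F e e) ⊗ₖ (1 : Matrix (Fin N) (Fin N) A) -
          (1 : Matrix (Fin N) (Fin N) A) ⊗ₖ (∑ e, F e e)) * casC) := by
  have hK (X : Matrix (Fin N) (Fin N) A) :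
      (X ⊗ₖ (1 : Matrix (Fin N) (Fin N) A)) * casC = kronOneMulC X := rfl
  have hL (X : Matrix (Fin N) (Fin N) A) :
      ((1 : Matrix (Fin N) (Fin N) A) ⊗ₖ X) * casC = oneKronMulC X := rfl
  simp only [← matBrHom_apply, sub_mul, smul_mul_assoc, hK, hL] at hFF ⊢
  have hleft (c d) : matBrHom P (∑ e, F e e) (F c d) =
      kronOneMulC (F c d) - oneKronMulC (F c d) := by
    simp [map_sum, AddMonoidHom.finsetSum_apply, hFF, ite_smul]
  have hright (a b) : matBrHom P (F a b) (∑ e, F e e) =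
      kronOneMulC (F a b) - oneKronMulC (F a b) := by
    simp [map_sum, hFF, ite_smul]
  have hboth : matBrHom P (∑ e, F e e) (∑ e, F e e) =
      kronOneMulC (∑ e, F e e) - oneKronMulC (∑ e, F e e) := by
    rw [map_sum (matBrHom P (∑ e, F e e)), Finset.sum_congr rfl fun e _ => hleft e e]
    simp only [Finset.sum_sub_distrib, map_sum]
  intro a b c d
  generalize ∑ e, F e e = S at *
  simp only [map_sub, AddMonoidHom.sub_apply, matBrHom_smul_left, matBrHom_smul_right,
    hleft, hright, hboth, hFF, map_smul]
  split_ifs <;> simp only [one_smul, zero_smul] <;> module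
end

section
/- Suppose the N×N matrices L and Q over A satisfy, for some N²×N² matrix R over A: {L ⊗, L} = [R, L ⊗ 1] − [R^π, 1 ⊗ L], {L ⊗, Q} = −[R^π, 1 ⊗ Q] + C, and {Q ⊗, Q} = 0. Define W_n^1 = Tr(L^n Q). Then for all n, m ≥ 1 the generators W_n^1 close a centerless Virasoro (Witt) algebra exactly: {W_n^1, W_m^1} = (n − m) W_{n+m−1}^1. -/
open Matrix Kronecker

/-- The matrix weighting `dL` in the differential of `trace (L ^ n * X)`, that is
`∑ L ^ a * X * L ^ b` over `a + b = n - 1` (and `0` for `n = 0`). -/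
def powGrad {A : Type*} [CommRing A] {n : Type*} [Fintype n] [DecidableEq n]
    (L : Matrix n n A) : ℕ → Matrix n n A → Matrix n n A
  | 0, _ => 0
  | k + 1, X => powGrad L k (L * X) + X * L ^ k

theorem mComm_powGrad {A : Type*} [CommRing A] {n : Type*} [Fintype n] [DecidableEq n]
    (L : Matrix n n A) (k : ℕ) (X : Matrix n n A) :
    mComm L (powGrad L k X) = mComm (L ^ k) X := by
  induction k generalizing X with
  | zero => simp [powGrad, mComm]
  | succ k ih =>
    have h := ih (L * X)
    simp only [mComm, powGrad] at h ⊢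
    rw [mul_add, add_mul, add_sub_add_comm, h, pow_succ]
    simp only [mul_assoc]
    rw [← pow_succ]
    abel

theorem trace_powGrad_mul_pow {A : Type*} [CommRing A] {n : Type*} [Fintype n] [DecidableEq n]
    (L : Matrix n n A) (k m : ℕ) (X : Matrix n n A) :
    (powGrad L k X * L ^ m).trace = k • (L ^ (k + m - 1) * X).trace := by
  induction k generalizing X with
  | zero => simp [powGrad]
  | succ k ih =>
    have h : k • (L ^ (k + m - 1) * (L * X)).trace = k • (L ^ (k + m) * X).trace := by
      rcases k with _ | k
      · simp
      · rw [← mul_assoc, ← pow_succ]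
        congr 4
        omega
    rw [powGrad, add_mul, trace_add, ih, h, mul_assoc, ← pow_add, trace_mul_comm X,
      succ_nsmul, show k + 1 + m - 1 = k + m by omega]

theorem Derivation.map_matrix_mul {A : Type*} [CommRing A] {n : Type*} [Fintype n]
    (D : Derivation ℤ A A) (X Y : Matrix n n A) :
    (X * Y).map D = X.map D * Y + X * Y.map D := by
  ext i j
  simp only [map_apply, mul_apply, Matrix.add_apply, map_sum, Derivation.leibniz, smul_eq_mul,
    ← Finset.sum_add_distrib]
  exact Finset.sum_congr rfl fun _ _ => by ring

theorem Derivation.trace_pow_mul {A : Type*} [CommRing A] {n : Type*} [Fintype n]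
    [DecidableEq n] (D : Derivation ℤ A A) (L X : Matrix n n A) (k : ℕ) :
    D (L ^ k * X).trace =
      (powGrad L k X * L.map D).trace + (L ^ k * X.map D).trace := by
  induction k generalizing X with
  | zero => simp [powGrad, trace, map_sum]
  | succ k ih =>
    rw [pow_succ, mul_assoc, ih, Derivation.map_matrix_mul, powGrad, add_mul, mul_add]
    simp only [trace_add]
    rw [mul_assoc X, trace_mul_comm X]
    simp only [mul_assoc]
    ring

namespace PoissonBr

variable {A : Type*} [CommRing A] (P : PoissonBr A)

/-- The Hamiltonian derivation `{x, ·}`. -/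
def ham (x : A) : Derivation ℤ A A :=
  Derivation.mk' (AddMonoidHom.mk' (P.br x) (P.add_right x)).toIntLinearMap fun y z => by
    simp only [AddMonoidHom.coe_toIntLinearMap, AddMonoidHom.mk'_apply, P.leibniz, smul_eq_mul]
    ring

theorem ham_apply (x y : A) : P.ham x y = P.br x y := rfl

theorem neg_ham_apply (x y : A) : (-P.ham y) x = P.br x y := by
  rw [Derivation.neg_apply, ham_apply, ← P.antisymm]

end PoissonBr

section Pairing

variable {A : Type*} [CommRing A] {N : ℕ}

theorem trace_mul_map_trace_mul (P : PoissonBr A) (X Y M M' : Matrix (Fin N) (Fin N) A) :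
    (X * M.map fun a => (Y * M'.map (P.ham a)).trace).trace =
      ((X ⊗ₖ Y) * matBr P M M').trace := by
  simp only [trace, diag_apply, mul_apply, map_apply, Fintype.sum_prod_type, kroneckerMap_apply,
    matBr, P.ham_apply, Finset.mul_sum]
  refine Finset.sum_congr rfl fun i _ => ?_
  rw [Finset.sum_comm]
  refine Finset.sum_congr rfl fun k _ => Finset.sum_congr rfl fun j _ =>
    Finset.sum_congr rfl fun l _ => by ring

theorem trace_kronecker_mul_piSwap (X Y : Matrix (Fin N) (Fin N) A)
    (R : Matrix (Fin N × Fin N) (Fin N × Fin N) A) :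
    ((X ⊗ₖ Y) * piSwap R).trace = ((Y ⊗ₖ X) * R).trace := by
  simp only [trace, diag_apply, mul_apply]
  refine Fintype.sum_equiv (Equiv.prodComm _ _) _ _ fun p => ?_
  refine Fintype.sum_equiv (Equiv.prodComm _ _) _ _ fun q => ?_
  simp [piSwap, Prod.swap, mul_comm (X _ _)]

theorem matBr_swap (P : PoissonBr A) (M M' : Matrix (Fin N) (Fin N) A) :
    matBr P M' M = -piSwap (matBr P M M') := by
  ext p q
  exact P.antisymm _ _

theorem trace_kronecker_mul_casC (X Y : Matrix (Fin N) (Fin N) A) :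
    ((X ⊗ₖ Y) * casC).trace = (X * Y).trace := by
  simp only [trace, diag_apply, mul_apply, Fintype.sum_prod_type, kroneckerMap_apply, casC]
  simp [ite_and]

theorem trace_mul_mComm {n : Type*} [Fintype n] (X R M : Matrix n n A) :
    (X * mComm R M).trace = (mComm M X * R).trace := by
  simp only [mComm, mul_sub, sub_mul, trace_sub, mul_assoc]
  rw [trace_mul_comm M, mul_assoc]

theorem mComm_kronecker_one (X Y M : Matrix (Fin N) (Fin N) A) :
    mComm (M ⊗ₖ (1 : Matrix (Fin N) (Fin N) A)) (X ⊗ₖ Y) = mComm M X ⊗ₖ Y := by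
  simp only [mComm, ← mul_kronecker_mul, one_mul, mul_one]
  ext
  simp [sub_mul]

theorem mComm_one_kronecker (X Y M : Matrix (Fin N) (Fin N) A) :
    mComm ((1 : Matrix (Fin N) (Fin N) A) ⊗ₖ M) (X ⊗ₖ Y) = X ⊗ₖ mComm M Y := by
  simp only [mComm, ← mul_kronecker_mul, one_mul, mul_one]
  ext
  simp [mul_sub]

theorem br_trace_pow_mul (P : PoissonBr A) (L Q : Matrix (Fin N) (Fin N) A) (n m : ℕ) :
    P.br (L ^ n * Q).trace (L ^ m * Q).trace =
      ((powGrad L n Q ⊗ₖ powGrad L m Q) * matBr P L L).trace +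
      ((powGrad L n Q ⊗ₖ (L ^ m)) * matBr P L Q).trace +
      (((L ^ n) ⊗ₖ powGrad L m Q) * matBr P Q L).trace +
      (((L ^ n) ⊗ₖ (L ^ m)) * matBr P Q Q).trace := by
  have h : ⇑(-P.ham (L ^ m * Q).trace) = fun a =>
      (powGrad L m Q * L.map (P.ham a)).trace + (L ^ m * Q.map (P.ham a)).trace := by
    ext a
    rw [P.neg_ham_apply, ← P.ham_apply, Derivation.trace_pow_mul]
  have map_add_fun (M : Matrix (Fin N) (Fin N) A) (f g : A → A) :
      M.map (fun a => f a + g a) = M.map f + M.map g := rfl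
  rw [← P.neg_ham_apply, Derivation.trace_pow_mul, h]
  simp only [map_add_fun, mul_add, trace_add, trace_mul_map_trace_mul]
  ring

end Pairing

theorem statement9 {A : Type*} [CommRing A] {N : ℕ} (P : PoissonBr A)
    (L Q : Matrix (Fin N) (Fin N) A)
    (R : Matrix (Fin N × Fin N) (Fin N × Fin N) A)
    (hLL : matBr P L L =
      mComm R (L ⊗ₖ (1 : Matrix (Fin N) (Fin N) A)) -
        mComm (piSwap R) ((1 : Matrix (Fin N) (Fin N) A) ⊗ₖ L))
    (hLQ : matBr P L Q =
      -mComm (piSwap R) ((1 : Matrix (Fin N) (Fin N) A) ⊗ₖ Q) + casC)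
    (hQQ : matBr P Q Q = 0) :
    ∀ n m : ℕ, 1 ≤ n → 1 ≤ m →
      P.br ((L ^ n * Q).trace) ((L ^ m * Q).trace) =
        ((n : ℤ) - (m : ℤ)) • ((L ^ (n + m - 1) * Q).trace) := by
  intro n m _ _
  have neg_mComm (X Y : Matrix (Fin N) (Fin N) A) : mComm X Y = -mComm Y X := by
    simp only [mComm, neg_sub]
  have kron_neg (X Y : Matrix (Fin N) (Fin N) A) : X ⊗ₖ (-Y) = -(X ⊗ₖ Y) := by
    ext; simp
  rw [br_trace_pow_mul, matBr_swap P L Q, mul_neg, trace_neg, trace_kronecker_mul_piSwap,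
    hLL, hLQ, hQQ]
  simp only [mul_sub, mul_add, mul_neg, trace_sub, trace_add, trace_neg, trace_mul_mComm,
    mComm_kronecker_one, mComm_one_kronecker, mComm_powGrad, trace_kronecker_mul_casC,
    trace_kronecker_mul_piSwap, trace_powGrad_mul_pow, neg_mComm Q, kron_neg, neg_mul,
    mul_zero, trace_zero, add_comm m n]
  simp only [sub_smul, natCast_zsmul]
  abel
end

section
/- With L and Q the rational Euler–Calogero–Moser matrices defined below, let ω be a real number and set L^± = L ± Q ± ωQ². Then the first external-field Hamiltonian has the explicit form: (1/2)·Tr(L^+ L^−) = (1/2) Σ_{i=1}^N p_i² − (1/2) Σ_{i≠j} F_{ij}F_{ji}/(q_i − q_j)² − (1/2) Σ_{i=1}^N (q_i² + 2ω q_i³ + ω² q_i⁴). -/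
open Matrix

/-- The trace of `(L + A) * (L - A)` is that of `L * L - A * A`, even if `L` and `A` do not
commute. -/
theorem Matrix.trace_add_mul_sub {n R : Type*} [Fintype n] [CommRing R] (L A : Matrix n n R) :
    ((L + A) * (L - A)).trace = (L * L).trace - (A * A).trace := by
  simp only [add_mul, mul_sub, trace_add, trace_sub, trace_mul_comm A L]
  ring

theorem statement14 {N r : ℕ} (hN : 1 ≤ N) (hr : 1 ≤ r)
    (p q : Fin N → ℝ) (hq : Function.Injective q)
    (ξ η : Fin N → Fin r → ℝ)
    (F : Matrix (Fin N) (Fin N) ℝ)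
    (hF : ∀ i j, F i j = ∑ a, ξ i a * η j a)
    (L Q : Matrix (Fin N) (Fin N) ℝ)
    (hLdiag : ∀ i, L i i = p i)
    (hLoff : ∀ i j, i ≠ j → L i j = -(F i j) / (q i - q j))
    (hQ : Q = Matrix.diagonal q) (ω : ℝ) :
    (1 / 2) * ((L + Q + ω • (Q * Q)) * (L - Q - ω • (Q * Q))).trace =
      (1 / 2) * ∑ i, (p i) ^ 2 -
      (1 / 2) * ∑ i, ∑ j, (if i = j then 0 else F i j * F j i / (q i - q j) ^ 2) -
      (1 / 2) * ∑ i, ((q i) ^ 2 + 2 * ω * (q i) ^ 3 + ω ^ 2 * (q i) ^ 4) := by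
  have hA : Q + ω • (Q * Q) = Matrix.diagonal fun i => q i + ω * q i ^ 2 := by
    ext i j
    rcases eq_or_ne i j with rfl | h
    · simp [hQ, sq]
    · simp [hQ, h]
  have hLL : (L * L).trace = ∑ i, p i ^ 2 -
      ∑ i, ∑ j, (if i = j then 0 else F i j * F j i / (q i - q j) ^ 2) := by
    have entry (i j : Fin N) : L i j * L j i = (if i = j then p i ^ 2 else 0) -
        (if i = j then 0 else F i j * F j i / (q i - q j) ^ 2) := by
      rcases eq_or_ne i j with rfl | h
      · simp [hLdiag, sq]
      · have hij : q i - q j ≠ 0 := sub_ne_zero.mpr (hq.ne h)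
        have hji : q j - q i ≠ 0 := sub_ne_zero.mpr (hq.ne h.symm)
        rw [hLoff i j h, hLoff j i h.symm, if_neg h, if_neg h]
        field_simp
        ring
    simp only [trace, diag_apply, mul_apply, entry, Finset.sum_sub_distrib, Finset.sum_ite_eq,
      Finset.mem_univ, if_true]
  have hAA : ((Q + ω • (Q * Q)) * (Q + ω • (Q * Q))).trace =
      ∑ i, (q i ^ 2 + 2 * ω * q i ^ 3 + ω ^ 2 * q i ^ 4) := by
    rw [hA, diagonal_mul_diagonal, trace_diagonal]
    exact Finset.sum_congr rfl fun i _ => by ring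
  rw [add_assoc, sub_sub, Matrix.trace_add_mul_sub, hLL, hAA]
  ring
end

section
/- With L, K, F the trigonometric Euler–Calogero–Moser matrices defined below and under the constraint F_{ii} = α for all i, one has the commutation relations [L, K] = 2FK − 2αK and [L, K^{−1}] = −2K^{−1}F + 2αK^{−1}. -/
open Matrix

/-- The commutator of `L` with `K⁻¹` is `-K⁻¹ * [L, K] * K⁻¹`. -/
theorem Matrix.commutator_inv_of_isUnit_det {n R : Type*} [Fintype n] [DecidableEq n] [CommRing R]
    (L : Matrix n n R) {K : Matrix n n R} (hK : IsUnit K.det) :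
    L * K⁻¹ - K⁻¹ * L = -(K⁻¹ * (L * K - K * L) * K⁻¹) := by
  rw [mul_sub, sub_mul, ← mul_assoc, ← mul_assoc, Matrix.nonsing_inv_mul K hK, one_mul,
    mul_assoc (K⁻¹ * L), Matrix.mul_nonsing_inv K hK, mul_one, neg_sub]

theorem statement15 {N r : ℕ} (hN : 1 ≤ N) (hr : 1 ≤ r)
    (p q : Fin N → ℝ) (hq : Function.Injective q)
    (ξ η : Fin N → Fin r → ℝ) (α : ℝ)
    (F : Matrix (Fin N) (Fin N) ℝ)
    (hF : ∀ i j, F i j = ∑ a, ξ i a * η j a)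
    (hα : ∀ i, F i i = α)
    (L K : Matrix (Fin N) (Fin N) ℝ)
    (hLdiag : ∀ i, L i i = p i + F i i)
    (hLoff : ∀ i j, i ≠ j → L i j = 2 * F i j / (1 - Real.exp (2 * (q i - q j))))
    (hK : K = Matrix.diagonal fun i => Real.exp (2 * q i)) :
    L * K - K * L = (2 : ℝ) • (F * K) - (2 * α) • K ∧
    L * K⁻¹ - K⁻¹ * L = -((2 : ℝ) • (K⁻¹ * F)) + (2 * α) • K⁻¹ := by
  have hdet : IsUnit K.det := by
    rw [hK, Matrix.det_diagonal, isUnit_iff_ne_zero]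
    exact Finset.prod_ne_zero_iff.mpr fun i _ => (Real.exp_pos _).ne'
  have hLK : L * K - K * L = (2 : ℝ) • (F * K) - (2 * α) • K := by
    subst hK
    ext i j
    simp only [Matrix.sub_apply, Matrix.smul_apply, Matrix.mul_diagonal, Matrix.diagonal_mul,
      smul_eq_mul]
    rcases eq_or_ne i j with rfl | hij
    · rw [Matrix.diagonal_apply_eq, hα]
      ring
    · have hne : Real.exp (2 * q j) - Real.exp (2 * q i) ≠ 0 := fun h =>
        hij (hq (by linarith [Real.exp_injective (sub_eq_zero.mp h)]))
      have hj : Real.exp (2 * q j) ≠ 0 := (Real.exp_pos _).ne'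
      rw [Matrix.diagonal_apply_ne _ hij, hLoff i j hij, mul_sub 2 (q i), Real.exp_sub,
        one_sub_div hj]
      field_simp
      ring
  refine ⟨hLK, ?_⟩
  rw [Matrix.commutator_inv_of_isUnit_det L hdet, hLK, mul_sub, sub_mul]
  simp only [Matrix.mul_smul, Matrix.smul_mul]
  rw [← mul_assoc K⁻¹ F K, mul_assoc (K⁻¹ * F), Matrix.mul_nonsing_inv K hdet,
    Matrix.nonsing_inv_mul K hdet, mul_one, one_mul]
  abel
end
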